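/- Let ρ be a real-valued radial neutral Schwartz function on ℝ², let m > 0, let v ∈ ℝ² with |v| < 1 and ω ∈ ℝ, and write D(k) = |k|² − (v·k)². Then the soliton linear momentum P_{v,ω} := mv − ⟨Π_{v,ω},∇_*A_{v,ω}⟩ + ⟨A_{v,ω},ρ⟩ has components (P_{v,ω})_j = m v_j + v_j ∫ |ρ̂(k)|²/D(k) dk − ∫ (v·k)k_j |ρ̂(k)|²/(|k|² D(k)) dk + ∫ (|v|² − (v·k)²/|k|²)(v·k)k_j |ρ̂(k)|²/D(k)² dk + ω² ∫ (v·k)k_j |∇ρ̂(k)|²/D(k)² dk, for j = 1, 2. -/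

import Mathlib

open MeasureTheory
open scoped RealInnerProductSpace BigOperators

noncomputable section

abbrev V2 : Type := EuclideanSpace ℝ (Fin 2)

/-- standard basis vector of ℝ² -/
def e2 (j : Fin 2) : V2 := EuclideanSpace.single j 1

/-- Fourier transform with normalization `(2π)⁻¹ ∫ e^{-ik·x} ρ(x) dx`. -/
def FT (ρ : V2 → ℝ) (k : V2) : ℂ :=
  ((2 * Real.pi : ℝ) : ℂ)⁻¹ * ∫ x : V2, Complex.exp (-Complex.I * ((⟪k, x⟫ : ℝ) : ℂ)) * (ρ x : ℂ)

/-- j-th partial derivative of a complex-valued function on ℝ². -/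
def pd (f : V2 → ℂ) (j : Fin 2) (k : V2) : ℂ := fderiv ℝ f k (e2 j)

/-- `|∇f(k)|²` for a complex-valued function on ℝ². -/
def gradNormSqC (f : V2 → ℂ) (k : V2) : ℝ := ∑ j, ‖pd f j k‖ ^ 2

/-- `D(k) = |k|² - (v·k)²`. -/
def Dv (v : V2) (k : V2) : ℝ := ‖k‖ ^ 2 - (⟪v, k⟫ : ℝ) ^ 2

/-- `(J ∇f)_j` where `J` has rows `(0,1)`, `(-1,0)`. -/
def Jgrad (f : V2 → ℂ) (j : Fin 2) (k : V2) : ℂ := ![pd f 1 k, -pd f 0 k] j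

/-- Fourier transform of the soliton field `A_{v,ω}`. -/
def Ahat (ρ : V2 → ℝ) (v : V2) (ω : ℝ) (j : Fin 2) (k : V2) : ℂ :=
  (((v j - k j * (⟪v, k⟫ : ℝ) / ‖k‖ ^ 2 : ℝ) : ℂ) * FT ρ k
      - Complex.I * (ω : ℂ) * Jgrad (FT ρ) j k) / ((Dv v k : ℝ) : ℂ)

/-- The soliton field `A_{v,ω}` (inverse Fourier transform of `Ahat`). -/
def Asol (ρ : V2 → ℝ) (v : V2) (ω : ℝ) (j : Fin 2) (y : V2) : ℝ :=
  (((2 * Real.pi : ℝ) : ℂ)⁻¹ *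
    ∫ k : V2, Complex.exp (Complex.I * ((⟪k, y⟫ : ℝ) : ℂ)) * Ahat ρ v ω j k).re

/-- The soliton field `Π_{v,ω} = -(v·∇) A_{v,ω}`. -/
def Pisol (ρ : V2 → ℝ) (v : V2) (ω : ℝ) (j : Fin 2) (y : V2) : ℝ :=
  - fderiv ℝ (Asol ρ v ω j) y v

/-- `|∇A(y)|² = ∑_{i,j} (∂_i A_j(y))²`. -/
def gradSq (A : Fin 2 → V2 → ℝ) (y : V2) : ℝ :=
  ∑ i, ∑ j, (fderiv ℝ (A j) y (e2 i)) ^ 2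

/-- Field energy `½∫ (|Π|² + |∇A|²)`. -/
def fieldEnergy (A Pf : Fin 2 → V2 → ℝ) : ℝ :=
  (1 / 2) * ∫ y : V2, ((∑ j, (Pf j y) ^ 2) + gradSq A y)

/-- `⟨Π, ∇_* A⟩_j = ∫ Π(y)·∂_j A(y) dy`. -/
def momTerm (A Pf : Fin 2 → V2 → ℝ) (j : Fin 2) : ℝ :=
  ∫ y : V2, ∑ l, Pf l y * fderiv ℝ (A l) y (e2 j)

/-- `⟨A, ρ⟩_j = ∫ A_j(y) ρ(y) dy`. -/
def chargeTerm (ρ : V2 → ℝ) (A : Fin 2 → V2 → ℝ) (j : Fin 2) : ℝ :=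
  ∫ y : V2, A j y * ρ y

/-- `∫ (Jy)·A(y) ρ(y) dy` where `(Jy) = (y₂, -y₁)`. -/
def angTerm (ρ : V2 → ℝ) (A : Fin 2 → V2 → ℝ) : ℝ :=
  ∫ y : V2, (y 1 * A 0 y - y 0 * A 1 y) * ρ y

/-- The reduced Hamiltonian `H_{P,M}(A,Π)`. -/
def Hred (m I : ℝ) (ρ : V2 → ℝ) (P : Fin 2 → ℝ) (M : ℝ) (A Pf : Fin 2 → V2 → ℝ) : ℝ :=
  fieldEnergy A Pf
    + (1 / (2 * m)) * ∑ j, (P j + momTerm A Pf j - chargeTerm ρ A j) ^ 2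
    + (1 / (2 * I)) * (M + angTerm ρ A) ^ 2

/-- The soliton linear momentum `P_{v,ω}`. -/
def Psol (ρ : V2 → ℝ) (m : ℝ) (v : V2) (ω : ℝ) (j : Fin 2) : ℝ :=
  m * v j - momTerm (Asol ρ v ω) (Pisol ρ v ω) j + chargeTerm ρ (Asol ρ v ω) j

/-- The soliton angular momentum `M_{v,ω}`. -/
def Msol (ρ : V2 → ℝ) (I : ℝ) (v : V2) (ω : ℝ) : ℝ :=
  I * ω - angTerm ρ (Asol ρ v ω)

/-- The inverse Fourier transform with normalization `(2π)⁻¹ ∫ e^{ik·y} f(k) dk`. -/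
def invFT (f : V2 → ℂ) (y : V2) : ℂ :=
  ((2 * Real.pi : ℝ) : ℂ)⁻¹ * ∫ k : V2, Complex.exp (Complex.I * ((⟪k, y⟫ : ℝ) : ℂ)) * f k

section Plancherel

open FourierTransform SchwartzMap
open scoped ComplexConjugate

variable {V : Type*} [NormedAddCommGroup V] [InnerProductSpace ℝ V] [FiniteDimensional ℝ V]
  [MeasurableSpace V] [BorelSpace V]

theorem continuous_fourier_of_integrable {f : V → ℂ} (hf : Integrable f) : Continuous (𝓕 f) :=
  VectorFourier.fourierIntegral_continuous Real.continuous_fourierChar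
    (by exact continuous_inner) hf

theorem integral_fourier_mul_eq_of_integrable {f g : V → ℂ} (hf : Integrable f)
    (hg : Integrable g) : ∫ x, 𝓕 f x * g x = ∫ x, f x * 𝓕 g x := by
  simpa using! VectorFourier.integral_fourierIntegral_smul_eq_flip (L := innerₗ V)
    Real.continuous_fourierChar continuous_inner hf hg

theorem fourier_toLp_ae_eq {f : V → ℂ} (hf : Integrable f) (hf2 : MemLp f 2) :
    𝓕 f =ᵐ[volume] (𝓕 (hf2.toLp f) : Lp (α := V) ℂ 2) := by
  refine ae_eq_of_integral_contDiff_smul_eq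
    (continuous_fourier_of_integrable hf).locallyIntegrable
    ((Lp.memLp _).locallyIntegrable (by norm_num)) fun g hg hgs => ?_
  have hgs' : HasCompactSupport (fun x => (g x : ℂ)) := hgs.comp_left Complex.ofReal_zero
  have hg' : ContDiff ℝ (⊤ : ℕ∞) (fun x => (g x : ℂ)) := Complex.ofRealCLM.contDiff.comp hg
  set φ : SchwartzMap V ℂ := hgs'.toSchwartzMap hg'
  have hφ : ∀ x, φ x = (g x : ℂ) := fun _ => rfl
  have key := congrArg (fun T => T φ) (Lp.fourier_toTemperedDistribution_eq (hf2.toLp f))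
  simp only [TemperedDistribution.fourier_apply, Lp.toTemperedDistribution_apply] at key
  have h1 : ∫ x, g x • 𝓕 f x = ∫ x, 𝓕 φ x • f x := by
    simp_rw [Complex.real_smul, ← hφ, smul_eq_mul, SchwartzMap.fourier_coe]
    exact (integral_fourier_mul_eq_of_integrable φ.integrable hf).symm
  have h2 : ∫ x, 𝓕 φ x • f x = ∫ x, 𝓕 φ x • hf2.toLp f x :=
    integral_congr_ae (by filter_upwards [hf2.coeFn_toLp] with x hx; rw [hx])
  rw [h1, h2, key]
  simp_rw [Complex.real_smul, ← hφ, smul_eq_mul]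

theorem memLp_two_fourier {f : V → ℂ} (hf : Integrable f) (hf2 : MemLp f 2) :
    MemLp (𝓕 f) 2 :=
  (Lp.memLp _).ae_eq (fourier_toLp_ae_eq hf hf2).symm

/-- Plancherel's theorem on `L¹ ∩ L²`. -/
theorem integral_conj_fourier_mul_fourier {f g : V → ℂ} (hf : Integrable f) (hf2 : MemLp f 2)
    (hg : Integrable g) (hg2 : MemLp g 2) :
    ∫ x, conj (𝓕 f x) * 𝓕 g x = ∫ x, conj (f x) * g x := by
  have key := Lp.inner_fourier_eq (hf2.toLp f) (hg2.toLp g)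
  rw [L2.inner_def, L2.inner_def] at key
  have h1 : ∫ x, conj (𝓕 f x) * 𝓕 g x =
      ∫ x, inner ℂ ((𝓕 (hf2.toLp f) : Lp (α := V) ℂ 2 volume) x)
        ((𝓕 (hg2.toLp g) : Lp (α := V) ℂ 2 volume) x) :=
    integral_congr_ae (by
      filter_upwards [fourier_toLp_ae_eq hf hf2, fourier_toLp_ae_eq hg hg2] with x hx hx'
      rw [hx, hx', RCLike.inner_apply, mul_comm])
  have h2 : ∫ x, conj (f x) * g x = ∫ x, inner ℂ (hf2.toLp f x) (hg2.toLp g x) :=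
    integral_congr_ae (by
      filter_upwards [hf2.coeFn_toLp, hg2.coeFn_toLp] with x hx hx'
      rw [hx, hx', RCLike.inner_apply, mul_comm])
  rw [h1, h2, key]

end Plancherel

section InverseFourier

open FourierTransform
open scoped ComplexConjugate

theorem invFT_eq_fourier (f : V2 → ℂ) (y : V2) :
    invFT f y = ((2 * Real.pi : ℝ) : ℂ)⁻¹ * 𝓕 f ((-(2 * Real.pi)⁻¹ : ℝ) • y) := by
  rw [invFT, Real.fourier_eq']
  congr 2
  ext k
  rw [inner_smul_right, smul_eq_mul]
  congr 2
  have : (Real.pi : ℂ) ≠ 0 := by exact_mod_cast Real.pi_ne_zero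
  push_cast
  field_simp

theorem memLp_two_invFT {f : V2 → ℂ} (hf : Integrable f) (hf2 : MemLp f 2) :
    MemLp (invFT f) 2 := by
  have hc : Continuous (𝓕 f) := continuous_fourier_of_integrable hf
  have hc' : Continuous (invFT f) := by
    simp_rw [funext (invFT_eq_fourier f)]
    fun_prop
  have h := (memLp_two_fourier hf hf2).integrable_norm_pow (by norm_num)
  rw [← memLp_norm_iff hc'.aestronglyMeasurable, memLp_two_iff_integrable_sq
    hc'.norm.aestronglyMeasurable]
  have h' := (h.comp_smul (R := -(2 * Real.pi)⁻¹) (by simp [Real.pi_ne_zero])).const_mul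
    (‖((2 * Real.pi : ℝ) : ℂ)⁻¹‖ ^ 2)
  refine h'.congr (Filter.Eventually.of_forall fun y => ?_)
  simp only [invFT_eq_fourier, norm_mul, mul_pow]

theorem integral_conj_invFT_mul_invFT {f g : V2 → ℂ} (hf : Integrable f) (hf2 : MemLp f 2)
    (hg : Integrable g) (hg2 : MemLp g 2) :
    ∫ y, conj (invFT f y) * invFT g y = ∫ k, conj (f k) * g k := by
  rw [← integral_conj_fourier_mul_fourier hf hf2 hg hg2]
  have h := Measure.integral_comp_smul (volume : Measure V2)
    (fun y => conj (𝓕 f y) * 𝓕 g y) (-(2 * Real.pi)⁻¹)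
  have hp : (Real.pi : ℂ) ≠ 0 := by exact_mod_cast Real.pi_ne_zero
  have e : ∀ y, conj (invFT f y) * invFT g y = ((2 * Real.pi : ℝ) : ℂ)⁻¹ ^ 2 *
      (conj (𝓕 f ((-(2 * Real.pi)⁻¹ : ℝ) • y)) * 𝓕 g ((-(2 * Real.pi)⁻¹ : ℝ) • y)) := by
    intro y
    rw [invFT_eq_fourier, invFT_eq_fourier, map_mul, map_inv₀, Complex.conj_ofReal]
    ring
  simp_rw [e]
  rw [integral_const_mul, h, finrank_euclideanSpace_fin, Complex.real_smul, ← mul_assoc]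
  rw [abs_of_nonneg (by positivity)]
  push_cast
  field_simp

theorem hasFDerivAt_invFT_apply {f : V2 → ℂ} (hf : Integrable f)
    (hf1 : Integrable fun k => ‖k‖ * ‖f k‖) (y : V2) :
    ∃ L : V2 →L[ℝ] ℂ, HasFDerivAt (invFT f) L y ∧
      ∀ w, L w = invFT (fun k => Complex.I * ((⟪k, w⟫ : ℝ) : ℂ) * f k) y := by
  set c : ℝ := -(2 * Real.pi)⁻¹ with hc
  have h1 := Real.hasFDerivAt_fourier hf hf1 (c • y)
  have h2 : HasFDerivAt (fun z : V2 => c • z) (c • ContinuousLinearMap.id ℝ V2) y :=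
    (hasFDerivAt_id y).const_smul c
  have h3 := (h1.comp y h2).const_mul (((2 * Real.pi : ℝ) : ℂ)⁻¹)
  rw [show invFT f = _ from funext (invFT_eq_fourier f)]
  refine ⟨_, h3, fun w => ?_⟩
  have hp : (Real.pi : ℂ) ≠ 0 := by exact_mod_cast Real.pi_ne_zero
  have hint : Integrable (VectorFourier.fourierSMulRight (innerSL ℝ) f) := by
    refine (hf1.const_mul (2 * Real.pi * ‖innerSL ℝ (E := V2)‖)).mono'
      (hf.aestronglyMeasurable.fourierSMulRight) (Filter.Eventually.of_forall fun k => ?_)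
    have := VectorFourier.norm_fourierSMulRight_le (innerSL ℝ (E := V2)) f k
    linarith
  rw [invFT_eq_fourier]
  simp only [smul_apply, ContinuousLinearMap.comp_apply,
    ContinuousLinearMap.id_apply, map_smul, smul_eq_mul]
  congr 1
  rw [Real.fourier_continuousLinearMap_apply hint, Real.fourier_eq', Real.fourier_eq',
    ← integral_smul]
  congr 1
  ext k
  simp only [VectorFourier.fourierSMulRight_apply, Complex.real_smul, smul_eq_mul, hc]
  push_cast
  field_simp
  exact mul_comm _ _

theorem conj_invFT {f : V2 → ℂ} (hf : ∀ k, f (-k) = conj (f k)) (y : V2) :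
    conj (invFT f y) = invFT f y := by
  rw [invFT, map_mul, ← integral_conj, ← integral_neg_eq_self, map_inv₀, Complex.conj_ofReal]
  congr 2
  ext k
  simp [hf, ← Complex.exp_conj]

theorem integral_invFT_mul {f g : V2 → ℂ} (hf : Integrable f) (hg : Integrable g) :
    ∫ y, invFT f y * g y = ∫ k, f k * invFT g k := by
  have e : ∀ f : V2 → ℂ, invFT f = fun y => ((2 * Real.pi : ℝ) : ℂ)⁻¹ *
      VectorFourier.fourierIntegral Real.probChar volume (-innerₗ V2) f y := by
    intro f
    ext y
    rw [invFT, VectorFourier.fourierIntegral_probChar]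
    congr 2
    ext k
    simp [mul_comm Complex.I]
  have hflip : (-innerₗ V2).flip = -innerₗ V2 := by
    ext x y
    simp [real_inner_comm]
  have h := VectorFourier.integral_fourierIntegral_smul_eq_flip (L := -innerₗ V2)
    (μ := volume) (ν := volume) Real.continuous_probChar (by
      simp only [LinearMap.neg_apply, innerₗ_apply_apply]
      exact continuous_inner.neg) hf hg
  rw [hflip] at h
  simp only [smul_eq_mul] at h
  simp_rw [e, mul_assoc, mul_left_comm (f _)]
  rw [integral_const_mul, integral_const_mul, h]

end InverseFourier
section ChargeTransform

open FourierTransform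
open scoped ComplexConjugate

theorem exists_schwartz_eq_FT (ρ : SchwartzMap V2 ℝ) :
    ∃ G : SchwartzMap V2 ℂ, ∀ k, G k = FT ρ k := by
  have hp : (2 * Real.pi)⁻¹ ≠ 0 := by simp [Real.pi_ne_zero]
  refine ⟨(((2 * Real.pi : ℝ) : ℂ)⁻¹) • SchwartzMap.compCLMOfContinuousLinearEquiv ℂ
    (ContinuousLinearEquiv.smulLeft (Units.mk0 ((2 * Real.pi)⁻¹ : ℝ) hp) : V2 ≃L[ℝ] V2)
    (𝓕 (SchwartzMap.postcompCLM Complex.ofRealCLM ρ)), fun k => ?_⟩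
  simp only [smul_apply, SchwartzMap.compCLMOfContinuousLinearEquiv_apply,
    Function.comp_apply, SchwartzMap.fourier_coe, Real.fourier_eq', FT, smul_eq_mul]
  congr 2
  ext x
  have hp' : (Real.pi : ℂ) ≠ 0 := by exact_mod_cast Real.pi_ne_zero
  congr 2
  change (((-2 * Real.pi * ⟪x, (2 * Real.pi)⁻¹ • k⟫ : ℝ) : ℂ)) * Complex.I = _
  rw [inner_smul_right, real_inner_comm]
  push_cast
  field_simp

theorem conj_FT (ρ : V2 → ℝ) (k : V2) : conj (FT ρ k) = FT ρ (-k) := by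
  rw [FT, map_mul, ← integral_conj, map_inv₀, Complex.conj_ofReal, FT]
  congr 2
  ext x
  simp [← Complex.exp_conj]

theorem invFT_ofReal (ρ : V2 → ℝ) (k : V2) : invFT (fun x => (ρ x : ℂ)) k = FT ρ (-k) := by
  rw [invFT, FT]
  congr 2
  ext x
  simp [real_inner_comm]

theorem FT_neg {ρ : V2 → ℝ} (hρ : ∀ x, ρ (-x) = ρ x) (k : V2) : FT ρ (-k) = FT ρ k := by
  rw [FT, ← integral_neg_eq_self, FT]
  simp [hρ]

theorem FT_zero {ρ : V2 → ℝ} (hρ : ∫ x, ρ x = 0) : FT ρ 0 = 0 := by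
  have h : ∫ x, (ρ x : ℂ) = 0 := by rw [integral_complex_ofReal, hρ, Complex.ofReal_zero]
  simp [FT, h]

theorem fderiv_FT_neg {ρ : V2 → ℝ} (hρ : ∀ x, ρ (-x) = ρ x) (k : V2) :
    fderiv ℝ (FT ρ) (-k) = -fderiv ℝ (FT ρ) k := by
  have h := fderiv_comp_smul (𝕜 := ℝ) (f := FT ρ) (c := (-1 : ℝ)) (x := k)
  simp_rw [neg_one_smul, FT_neg hρ] at h
  rw [h, neg_neg]

theorem pd_FT_neg {ρ : V2 → ℝ} (hρ : ∀ x, ρ (-x) = ρ x) (j : Fin 2) (k : V2) :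
    pd (FT ρ) j (-k) = -pd (FT ρ) j k := by
  rw [pd, fderiv_FT_neg hρ, neg_apply, pd]

theorem conj_pd_FT (ρ : SchwartzMap V2 ℝ) (hρ : ∀ x, ρ (-x) = ρ x) (j : Fin 2) (k : V2) :
    conj (pd (FT ρ) j k) = pd (FT ρ) j k := by
  obtain ⟨G, hG⟩ := exists_schwartz_eq_FT ρ
  have hG' : ⇑G = FT ρ := funext hG
  have hc : (fun k => Complex.conjCLE (FT ρ k)) = FT ρ := by
    ext k
    rw [Complex.conjCLE_apply, conj_FT, FT_neg hρ]
  have hd : DifferentiableAt ℝ (FT ρ) k := hG' ▸ G.differentiableAt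
  have h := (Complex.conjCLE.toContinuousLinearMap.hasFDerivAt.comp k hd.hasFDerivAt).fderiv
  have h' : fderiv ℝ (FT ρ) k = _ := (congrArg (fun f => fderiv ℝ f k) hc).symm.trans h
  conv_rhs => rw [pd, h']
  simp [pd]

/-- The weight `(1 + ‖k‖)⁻⁴`, integrable on `ℝ²`. -/
def weight (k : V2) : ℝ := ((1 + ‖k‖) ^ 4)⁻¹

theorem weight_pos (k : V2) : 0 < weight k := by unfold weight; positivity

theorem weight_le_one (k : V2) : weight k ≤ 1 :=
  inv_le_one_of_one_le₀ (one_le_pow₀ (by linarith [norm_nonneg k]))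

theorem integrable_weight : Integrable weight := by
  have h := integrable_one_add_norm (E := V2) (μ := volume) (r := 4)
    (by rw [finrank_euclideanSpace_fin]; norm_num)
  refine h.congr (Filter.Eventually.of_forall fun k => ?_)
  have : (0 : ℝ) < 1 + ‖k‖ := by positivity
  simp only [weight]
  rw [Real.rpow_neg this.le]
  norm_cast

theorem integrable_inv_norm_mul_weight : Integrable fun k : V2 => ‖k‖⁻¹ * weight k := by
  have h := integrable_fun_norm_addHaar (volume : Measure V2)
    (f := fun y : ℝ => y⁻¹ * ((1 + y) ^ 4)⁻¹)
  refine h.2 ?_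
  have h1 : IntegrableOn (fun y : ℝ => (1 + ‖y‖) ^ (-4 : ℝ)) (Set.Ioi 0) :=
    (integrable_one_add_norm (E := ℝ) (μ := volume) (r := 4) (by simp)).integrableOn
  refine h1.congr_fun (fun y hy => ?_) measurableSet_Ioi
  have hy : 0 < y := hy
  have : (0 : ℝ) < 1 + y := by positivity
  simp only [finrank_euclideanSpace_fin, smul_eq_mul, Real.norm_eq_abs, abs_of_pos hy]
  rw [Real.rpow_neg this.le]
  norm_num
  field_simp

theorem SchwartzMap.exists_norm_le_mul_weight {F : Type*} [NormedAddCommGroup F]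
    [NormedSpace ℝ F] (S : SchwartzMap V2 F) (h0 : S 0 = 0) :
    ∃ C, 0 ≤ C ∧ ∀ k, ‖S k‖ ≤ C * (‖k‖ * weight k) := by
  set C₀ := 2 ^ 4 * (Finset.Iic ((4, 0) : ℕ × ℕ)).sup
    (fun m => SchwartzMap.seminorm ℝ m.1 m.2) S
  set C₁ := SchwartzMap.seminorm ℝ 0 1 S
  have hC₀ : 0 ≤ C₀ := by positivity
  have hC₁ : 0 ≤ C₁ := by positivity
  have hb₀ : ∀ k, (1 + ‖k‖) ^ 4 * ‖S k‖ ≤ C₀ := fun k => by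
    simpa using S.one_add_le_sup_seminorm_apply (𝕜 := ℝ) (m := (4, 0)) le_rfl le_rfl k
  have hb₁ : ∀ k, ‖S k‖ ≤ C₁ * ‖k‖ := fun k => by
    have := convex_univ.norm_image_sub_le_of_norm_fderiv_le (𝕜 := ℝ) (f := S) (C := C₁)
      (fun x _ => S.differentiableAt) (fun x _ => by
        simpa [norm_iteratedFDeriv_one] using S.norm_iteratedFDeriv_le_seminorm ℝ 1 x)
      (Set.mem_univ 0) (Set.mem_univ k)
    simpa [h0] using this
  refine ⟨C₀ + 2 ^ 4 * C₁, by positivity, fun k => ?_⟩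
  have hw : 0 < (1 + ‖k‖) ^ 4 := by positivity
  rw [weight, ← mul_assoc, ← div_eq_mul_inv, le_div_iff₀ hw]
  rcases le_total ‖k‖ 1 with hk | hk
  · have h2 : (1 + ‖k‖) ^ 4 ≤ 2 ^ 4 := by gcongr; linarith
    calc ‖S k‖ * (1 + ‖k‖) ^ 4 ≤ C₁ * ‖k‖ * 2 ^ 4 := by gcongr; exact hb₁ k
      _ ≤ _ := by nlinarith [mul_nonneg hC₀ (norm_nonneg k)]
  · have := hb₀ k
    have h3 := mul_le_mul_of_nonneg_left hk hC₀
    have h4 : 0 ≤ 2 ^ 4 * C₁ * ‖k‖ := by positivity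
    linarith

theorem exists_norm_FT_le (ρ : SchwartzMap V2 ℝ) (hρ : ∀ x, ρ (-x) = ρ x)
    (hneu : ∫ x, ρ x = 0) :
    ∃ C, 0 ≤ C ∧ (∀ k, ‖FT ρ k‖ ≤ C * (‖k‖ * weight k)) ∧
      ∀ j k, ‖pd (FT ρ) j k‖ ≤ C * (‖k‖ * weight k) := by
  obtain ⟨G, hG⟩ := exists_schwartz_eq_FT ρ
  have hG' : ⇑G = FT ρ := funext hG
  obtain ⟨C, hC, hCb⟩ := G.exists_norm_le_mul_weight (by rw [hG, FT_zero hneu])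
  have h0 : fderiv ℝ (FT ρ) 0 = 0 := by
    ext w
    have h := congrArg (fun L => L w) (fderiv_FT_neg hρ 0)
    rw [neg_zero] at h
    exact self_eq_neg.1 h
  obtain ⟨C', hC', hCb'⟩ := (SchwartzMap.fderivCLM ℝ V2 ℂ G).exists_norm_le_mul_weight
    (by rw [SchwartzMap.fderivCLM_apply, hG', h0])
  have hw : ∀ k : V2, 0 ≤ ‖k‖ * weight k := fun k => mul_nonneg (norm_nonneg k) (weight_pos k).le
  refine ⟨C + C', by positivity, fun k => ?_, fun j k => ?_⟩
  · rw [← hG]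
    exact (hCb k).trans (mul_le_mul_of_nonneg_right (by linarith) (hw k))
  · have h1 : ‖pd (FT ρ) j k‖ ≤ ‖fderiv ℝ (FT ρ) k‖ := by
      simpa [pd, e2] using (fderiv ℝ (FT ρ) k).le_opNorm (e2 j)
    have h2 := hCb' k
    rw [SchwartzMap.fderivCLM_apply, hG'] at h2
    exact (h1.trans h2).trans (mul_le_mul_of_nonneg_right (by linarith) (hw k))

theorem continuous_FT (ρ : SchwartzMap V2 ℝ) : Continuous (FT ρ) := by
  obtain ⟨G, hG⟩ := exists_schwartz_eq_FT ρ
  exact (funext hG : ⇑G = FT ρ) ▸ G.continuous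

theorem continuous_pd_FT (ρ : SchwartzMap V2 ℝ) (j : Fin 2) : Continuous (pd (FT ρ) j) := by
  obtain ⟨G, hG⟩ := exists_schwartz_eq_FT ρ
  have h : Continuous fun k => fderiv ℝ (FT ρ) k (e2 j) := by
    rw [← (funext hG : ⇑G = FT ρ)]
    exact ((SchwartzMap.fderivCLM ℝ V2 ℂ G).continuous).clm_apply continuous_const
  exact h

end ChargeTransform
section SolitonField

open scoped ComplexConjugate

theorem integrable_of_norm_le_weight {f : V2 → ℂ} {C : ℝ} (hf : AEStronglyMeasurable f)
    (hb : ∀ k, ‖f k‖ ≤ C * weight k) : Integrable f :=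
  (integrable_weight.const_mul C).mono' hf (Filter.Eventually.of_forall hb)

theorem memLp_two_of_norm_le_weight {f : V2 → ℂ} {C : ℝ} (hf : AEStronglyMeasurable f)
    (hb : ∀ k, ‖f k‖ ≤ C * weight k) : MemLp f 2 := by
  rw [← memLp_norm_iff hf, memLp_two_iff_integrable_sq hf.norm]
  refine (integrable_weight.const_mul (C ^ 2)).mono' (hf.norm.pow 2)
    (Filter.Eventually.of_forall fun k => ?_)
  rw [Real.norm_of_nonneg (by positivity)]
  calc ‖f k‖ ^ 2 ≤ (C * weight k) ^ 2 := by gcongr; exact hb k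
    _ = C ^ 2 * weight k * weight k := by ring
    _ ≤ C ^ 2 * weight k * 1 := by
      have := weight_pos k
      gcongr
      exact weight_le_one k
    _ = _ := mul_one _

theorem integral_re_invFT_mul_re_invFT {f g : V2 → ℂ} (hf : Integrable f) (hf2 : MemLp f 2)
    (hg : Integrable g) (hg2 : MemLp g 2) (hfc : ∀ k, f (-k) = conj (f k)) :
    Integrable (fun y => (invFT f y).re * (invFT g y).re) ∧
      ∫ y, (invFT f y).re * (invFT g y).re = (∫ k, conj (f k) * g k).re := by
  have e : ∀ y, (invFT f y).re * (invFT g y).re = (conj (invFT f y) * invFT g y).re := by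
    intro y
    obtain ⟨r, hr⟩ := Complex.conj_eq_iff_real.1 (conj_invFT hfc y)
    simp [hr]
  have hi : Integrable fun y => conj (invFT f y) * invFT g y :=
    (memLp_two_invFT hf hf2).star.integrable_mul (memLp_two_invFT hg hg2)
  simp_rw [e]
  refine ⟨hi.re, ?_⟩
  rw [← integral_conj_invFT_mul_invFT hf hf2 hg hg2]
  exact integral_re hi

theorem Dv_neg (v k : V2) : Dv v (-k) = Dv v k := by simp [Dv]

theorem le_Dv (v k : V2) : (1 - ‖v‖ ^ 2) * ‖k‖ ^ 2 ≤ Dv v k := by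
  have h := abs_real_inner_le_norm v k
  have h2 : (⟪v, k⟫ : ℝ) ^ 2 ≤ (‖v‖ * ‖k‖) ^ 2 := sq_le_sq' (by linarith [abs_le.1 h |>.1])
    (abs_le.1 h).2
  rw [Dv]
  nlinarith

theorem measurable_Dv (v : V2) : Measurable (Dv v) := by unfold Dv; fun_prop

theorem Ahat_neg (ρ : SchwartzMap V2 ℝ) (hρ : ∀ x, ρ (-x) = ρ x) (v : V2) (ω : ℝ) (j : Fin 2)
    (k : V2) : Ahat ρ v ω j (-k) = conj (Ahat ρ v ω j k) := by
  have hF : conj (FT ρ k) = FT ρ k := by rw [conj_FT, FT_neg hρ]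
  fin_cases j <;>
    simp [Ahat, Jgrad, Dv_neg, FT_neg hρ, pd_FT_neg hρ, hF, conj_pd_FT ρ hρ, sub_eq_add_neg]

theorem measurable_Ahat (ρ : SchwartzMap V2 ℝ) (v : V2) (ω : ℝ) (j : Fin 2) :
    Measurable (Ahat ρ v ω j) := by
  have h1 := (continuous_FT ρ).measurable
  have h2 := fun i => (continuous_pd_FT ρ i).measurable
  have h3 : Measurable (Jgrad (FT ρ) j) := by
    fin_cases j
    · exact h2 1
    · exact (h2 0).neg
  have h4 := measurable_Dv v
  unfold Ahat
  fun_prop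

theorem abs_coord_le_norm (k : V2) (j : Fin 2) : |k j| ≤ ‖k‖ := by
  simpa using PiLp.norm_apply_le k j

theorem exists_norm_Ahat_le (ρ : SchwartzMap V2 ℝ) (hρ : ∀ x, ρ (-x) = ρ x)
    (hneu : ∫ x, ρ x = 0) {v : V2} (hv : ‖v‖ < 1) (ω : ℝ) :
    ∃ C, 0 ≤ C ∧ ∀ j k, ‖Ahat ρ v ω j k‖ ≤ C * (‖k‖⁻¹ * weight k) := by
  obtain ⟨C, hC, hF, hP⟩ := exists_norm_FT_le ρ hρ hneu
  have hδ : 0 < 1 - ‖v‖ ^ 2 := by nlinarith [norm_nonneg v]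
  refine ⟨(2 * C + |ω| * C) / (1 - ‖v‖ ^ 2), by positivity, fun j k => ?_⟩
  rcases eq_or_ne k 0 with rfl | hk
  · simp [Ahat, Dv]
  have hk : 0 < ‖k‖ := norm_pos_iff.2 hk
  have hD := le_Dv v k
  have hw := weight_pos k
  have h1 : ‖v j - k j * ⟪v, k⟫ / ‖k‖ ^ 2‖ ≤ 2 := by
    refine (norm_sub_le _ _).trans ?_
    have hv1 : ‖v j‖ ≤ 1 := (abs_coord_le_norm v j).trans hv.le
    have hv2 : ‖k j * ⟪v, k⟫ / ‖k‖ ^ 2‖ ≤ 1 := by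
      rw [norm_div, norm_mul, norm_pow, norm_norm, div_le_one (by positivity)]
      calc ‖k j‖ * ‖(⟪v, k⟫ : ℝ)‖ ≤ ‖k‖ * (‖v‖ * ‖k‖) :=
            mul_le_mul (abs_coord_le_norm k j) (abs_real_inner_le_norm v k) (norm_nonneg _)
              hk.le
        _ ≤ ‖k‖ * (1 * ‖k‖) := by gcongr
        _ = ‖k‖ ^ 2 := by ring
    linarith
  have h2 : ‖Jgrad (FT ρ) j k‖ ≤ C * (‖k‖ * weight k) := by
    fin_cases j
    · exact hP 1 k
    · simpa [Jgrad] using hP 0 k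
  have hDpos : 0 < Dv v k := lt_of_lt_of_le (by positivity) hD
  rw [Ahat, norm_div, Complex.norm_real, Real.norm_of_nonneg hDpos.le, div_le_iff₀ hDpos]
  calc _ ≤ ‖v j - k j * ⟪v, k⟫ / ‖k‖ ^ 2‖ * ‖FT ρ k‖ + |ω| * ‖Jgrad (FT ρ) j k‖ := by
        refine (norm_sub_le _ _).trans (le_of_eq ?_)
        simp only [norm_mul, Complex.norm_real, Complex.norm_I, one_mul]
        rfl
    _ ≤ 2 * (C * (‖k‖ * weight k)) + |ω| * (C * (‖k‖ * weight k)) := by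
        gcongr
        exact hF k
    _ = (2 * C + |ω| * C) / (1 - ‖v‖ ^ 2) * (‖k‖⁻¹ * weight k) * ((1 - ‖v‖ ^ 2) * ‖k‖ ^ 2) := by
        field_simp
    _ ≤ _ := by gcongr

theorem integrable_Ahat (ρ : SchwartzMap V2 ℝ) (hρ : ∀ x, ρ (-x) = ρ x)
    (hneu : ∫ x, ρ x = 0) {v : V2} (hv : ‖v‖ < 1) (ω : ℝ) (j : Fin 2) :
    Integrable (Ahat ρ v ω j) := by
  obtain ⟨C, -, hb⟩ := exists_norm_Ahat_le ρ hρ hneu hv ω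
  exact (integrable_inv_norm_mul_weight.const_mul C).mono'
    (measurable_Ahat ρ v ω j).aestronglyMeasurable (Filter.Eventually.of_forall (hb j))

/-- The Fourier transform of the derivative of the soliton field in the direction `w`. -/
def dAhat (ρ : V2 → ℝ) (v : V2) (ω : ℝ) (l : Fin 2) (w k : V2) : ℂ :=
  Complex.I * ((⟪k, w⟫ : ℝ) : ℂ) * Ahat ρ v ω l k

theorem measurable_dAhat (ρ : SchwartzMap V2 ℝ) (v : V2) (ω : ℝ) (l : Fin 2) (w : V2) :
    Measurable (dAhat ρ v ω l w) := by
  have := measurable_Ahat ρ v ω l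
  unfold dAhat
  fun_prop

theorem dAhat_neg (ρ : SchwartzMap V2 ℝ) (hρ : ∀ x, ρ (-x) = ρ x) (v : V2) (ω : ℝ) (l : Fin 2)
    (w k : V2) : dAhat ρ v ω l w (-k) = conj (dAhat ρ v ω l w k) := by
  simp [dAhat, Ahat_neg ρ hρ]

theorem exists_norm_dAhat_le (ρ : SchwartzMap V2 ℝ) (hρ : ∀ x, ρ (-x) = ρ x)
    (hneu : ∫ x, ρ x = 0) {v : V2} (hv : ‖v‖ < 1) (ω : ℝ) (l : Fin 2) (w : V2) :
    ∃ C, ∀ k, ‖dAhat ρ v ω l w k‖ ≤ C * weight k := by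
  obtain ⟨C, hC, hb⟩ := exists_norm_Ahat_le ρ hρ hneu hv ω
  refine ⟨‖w‖ * C, fun k => ?_⟩
  have hw := weight_pos k
  rw [dAhat, norm_mul, norm_mul, Complex.norm_I, one_mul, Complex.norm_real]
  calc _ ≤ ‖k‖ * ‖w‖ * (C * (‖k‖⁻¹ * weight k)) := by
        gcongr
        · exact norm_inner_le_norm k w
        · exact hb l k
    _ = ‖w‖ * C * weight k * (‖k‖ * ‖k‖⁻¹) := by ring
    _ ≤ ‖w‖ * C * weight k * 1 := by
        gcongr
        exact mul_inv_le_one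
    _ = _ := mul_one _

theorem integrable_dAhat (ρ : SchwartzMap V2 ℝ) (hρ : ∀ x, ρ (-x) = ρ x)
    (hneu : ∫ x, ρ x = 0) {v : V2} (hv : ‖v‖ < 1) (ω : ℝ) (l : Fin 2) (w : V2) :
    Integrable (dAhat ρ v ω l w) :=
  (exists_norm_dAhat_le ρ hρ hneu hv ω l w).elim fun _ hb =>
    integrable_of_norm_le_weight (measurable_dAhat ρ v ω l w).aestronglyMeasurable hb

theorem memLp_dAhat (ρ : SchwartzMap V2 ℝ) (hρ : ∀ x, ρ (-x) = ρ x)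
    (hneu : ∫ x, ρ x = 0) {v : V2} (hv : ‖v‖ < 1) (ω : ℝ) (l : Fin 2) (w : V2) :
    MemLp (dAhat ρ v ω l w) 2 :=
  (exists_norm_dAhat_le ρ hρ hneu hv ω l w).elim fun _ hb =>
    memLp_two_of_norm_le_weight (measurable_dAhat ρ v ω l w).aestronglyMeasurable hb

theorem fderiv_Asol (ρ : SchwartzMap V2 ℝ) (hρ : ∀ x, ρ (-x) = ρ x)
    (hneu : ∫ x, ρ x = 0) {v : V2} (hv : ‖v‖ < 1) (ω : ℝ) (l : Fin 2) (y w : V2) :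
    fderiv ℝ (Asol ρ v ω l) y w = (invFT (dAhat ρ v ω l w) y).re := by
  obtain ⟨C, hC, hb⟩ := exists_norm_Ahat_le ρ hρ hneu hv ω
  have h1 : Integrable fun k => ‖k‖ * ‖Ahat ρ v ω l k‖ := by
    refine (integrable_weight.const_mul C).mono'
      (measurable_norm.mul (measurable_Ahat ρ v ω l).norm).aestronglyMeasurable
      (Filter.Eventually.of_forall fun k => ?_)
    have hw := weight_pos k
    rw [Real.norm_of_nonneg (by positivity)]
    calc _ ≤ ‖k‖ * (C * (‖k‖⁻¹ * weight k)) := by gcongr; exact hb l k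
      _ = C * weight k * (‖k‖ * ‖k‖⁻¹) := by ring
      _ ≤ C * weight k * 1 := by
        gcongr
        exact mul_inv_le_one
      _ = _ := mul_one _
  obtain ⟨L, hL, hLw⟩ := hasFDerivAt_invFT_apply (integrable_Ahat ρ hρ hneu hv ω l) h1 y
  have h2 : HasFDerivAt (Asol ρ v ω l) (Complex.reCLM ∘L L) y :=
    Complex.reCLM.hasFDerivAt.comp y hL
  rw [h2.fderiv, ContinuousLinearMap.comp_apply, hLw]
  rfl

theorem inner_e2 (k : V2) (j : Fin 2) : (⟪k, e2 j⟫ : ℝ) = k j := by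
  simp [e2, EuclideanSpace.inner_single_right]

theorem norm_sq_V2 (k : V2) : ‖k‖ ^ 2 = k 0 ^ 2 + k 1 ^ 2 := by
  simp [EuclideanSpace.norm_sq_eq]

theorem inner_V2 (v k : V2) : (⟪v, k⟫ : ℝ) = v 0 * k 0 + v 1 * k 1 := by
  simp [PiLp.inner_apply, mul_comm]

theorem sum_norm_sq_Ahat (ρ : SchwartzMap V2 ℝ) (hρ : ∀ x, ρ (-x) = ρ x) (v : V2) (ω : ℝ)
    (k : V2) :
    ∑ l, ‖Ahat ρ v ω l k‖ ^ 2 =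
      (‖v‖ ^ 2 - (⟪v, k⟫ : ℝ) ^ 2 / ‖k‖ ^ 2) * ‖FT ρ k‖ ^ 2 / Dv v k ^ 2
        + ω ^ 2 * (gradNormSqC (FT ρ) k / Dv v k ^ 2) := by
  rcases eq_or_ne k 0 with rfl | hk
  · simp [Ahat, Dv]
  obtain ⟨r, hr⟩ := Complex.conj_eq_iff_real.1 (show conj (FT ρ k) = FT ρ k by
    rw [conj_FT, FT_neg hρ])
  obtain ⟨p, hp⟩ := Complex.conj_eq_iff_real.1 (conj_pd_FT ρ hρ 0 k)
  obtain ⟨q, hq⟩ := Complex.conj_eq_iff_real.1 (conj_pd_FT ρ hρ 1 k)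
  have key : ∀ a b : ℝ, ‖(a : ℂ) * r - Complex.I * ω * b‖ ^ 2 = a ^ 2 * r ^ 2 + ω ^ 2 * b ^ 2 := by
    intro a b
    rw [← Complex.normSq_eq_norm_sq, Complex.normSq_apply]
    simp
    ring
  have hk2 : k 0 ^ 2 + k 1 ^ 2 ≠ 0 := by
    rw [← norm_sq_V2]
    exact pow_ne_zero 2 (norm_ne_zero_iff.2 hk)
  have hn : ∀ x : ℝ, ‖(x : ℂ)‖ ^ 2 = x ^ 2 := fun x => by rw [Complex.norm_real]; exact sq_abs x
  rw [Fin.sum_univ_two, Ahat, Ahat, gradNormSqC, Fin.sum_univ_two]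
  simp only [Jgrad, Matrix.cons_val_zero, Matrix.cons_val_one, hr, hp, hq, norm_div, div_pow, hn]
  rw [← Complex.ofReal_neg, key, key, norm_sq_V2, norm_sq_V2, inner_V2, ← add_div, ← mul_div_assoc,
    ← add_div]
  congr 1
  field_simp
  ring

theorem re_conj_dAhat_mul_dAhat (ρ : V2 → ℝ) (v : V2) (ω : ℝ) (l j : Fin 2) (k : V2) :
    conj (dAhat ρ v ω l v k) * dAhat ρ v ω l (e2 j) k =
      ((⟪v, k⟫ * k j * ‖Ahat ρ v ω l k‖ ^ 2 : ℝ) : ℂ) := by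
  rw [dAhat, dAhat, inner_e2, real_inner_comm]
  have h := Complex.conj_mul' (Ahat ρ v ω l k)
  simp only [map_mul, Complex.conj_I, Complex.conj_ofReal]
  push_cast
  rw [← h]
  linear_combination (-(⟪v, k⟫ : ℂ) * k j * conj (Ahat ρ v ω l k) * Ahat ρ v ω l k) *
    Complex.I_sq

theorem momTerm_soliton (ρ : SchwartzMap V2 ℝ) (hρ : ∀ x, ρ (-x) = ρ x)
    (hneu : ∫ x, ρ x = 0) {v : V2} (hv : ‖v‖ < 1) (ω : ℝ) (j : Fin 2) :
    momTerm (Asol ρ v ω) (Pisol ρ v ω) j =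
      -∫ k, ⟪v, k⟫ * k j * ∑ l, ‖Ahat ρ v ω l k‖ ^ 2 := by
  have h := fun l => integral_re_invFT_mul_re_invFT (integrable_dAhat ρ hρ hneu hv ω l v)
    (memLp_dAhat ρ hρ hneu hv ω l v) (integrable_dAhat ρ hρ hneu hv ω l (e2 j))
    (memLp_dAhat ρ hρ hneu hv ω l (e2 j)) (dAhat_neg ρ hρ v ω l v)
  have hi : ∀ l, Integrable fun k => (⟪v, k⟫ : ℝ) * k j * ‖Ahat ρ v ω l k‖ ^ 2 := fun l => by
    have := (memLp_dAhat ρ hρ hneu hv ω l v).star.integrable_mul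
      (memLp_dAhat ρ hρ hneu hv ω l (e2 j))
    refine this.re.congr (Filter.Eventually.of_forall fun k => ?_)
    have h := congrArg Complex.re (re_conj_dAhat_mul_dAhat ρ v ω l j k)
    rw [Complex.ofReal_re] at h
    exact h
  simp_rw [re_conj_dAhat_mul_dAhat, integral_complex_ofReal, Complex.ofReal_re] at h
  simp_rw [momTerm, Pisol, fderiv_Asol ρ hρ hneu hv, neg_mul, Finset.sum_neg_distrib,
    Finset.mul_sum]
  rw [integral_neg, integral_finsetSum _ fun l _ => (h l).1,
    integral_finsetSum _ fun l _ => hi l]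
  exact congrArg _ (Finset.sum_congr rfl fun l _ => (h l).2)

theorem chargeTerm_soliton (ρ : SchwartzMap V2 ℝ) (hρ : ∀ x, ρ (-x) = ρ x)
    (hneu : ∫ x, ρ x = 0) {v : V2} (hv : ‖v‖ < 1) (ω : ℝ) (j : Fin 2) :
    chargeTerm ρ (Asol ρ v ω) j =
      ∫ k, (v j - k j * ⟪v, k⟫ / ‖k‖ ^ 2) * ‖FT ρ k‖ ^ 2 / Dv v k := by
  have hA := integrable_Ahat ρ hρ hneu hv ω j
  have hr : Integrable fun x => (ρ x : ℂ) := ρ.integrable.ofReal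
  have h := integral_invFT_mul hA hr
  have hreal : ∀ y, (invFT (Ahat ρ v ω j) y * ρ y) = ((Asol ρ v ω j y * ρ y : ℝ) : ℂ) := by
    intro y
    obtain ⟨a, ha⟩ := Complex.conj_eq_iff_real.1 (conj_invFT (Ahat_neg ρ hρ v ω j) y)
    have : Asol ρ v ω j y = (invFT (Ahat ρ v ω j) y).re := rfl
    rw [this, ha, Complex.ofReal_re, Complex.ofReal_mul]
  have hprod : ∀ k, (Ahat ρ v ω j k * invFT (fun x => (ρ x : ℂ)) k).re =
      (v j - k j * ⟪v, k⟫ / ‖k‖ ^ 2) * ‖FT ρ k‖ ^ 2 / Dv v k := by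
    intro k
    rw [invFT_ofReal, FT_neg hρ]
    obtain ⟨r, hr⟩ := Complex.conj_eq_iff_real.1 (show conj (FT ρ k) = FT ρ k by
      rw [conj_FT, FT_neg hρ])
    have hJ : conj (Jgrad (FT ρ) j k) = Jgrad (FT ρ) j k := by
      fin_cases j <;> simp [Jgrad, conj_pd_FT ρ hρ]
    obtain ⟨b, hb⟩ := Complex.conj_eq_iff_real.1 hJ
    have hn : ‖(r : ℂ)‖ ^ 2 = r ^ 2 := by rw [Complex.norm_real]; exact sq_abs r
    have key : ∀ a : ℝ, (((a : ℂ) * r - Complex.I * ω * b) * r).re = a * r ^ 2 := by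
      intro a
      simp
      ring
    rw [Ahat, hr, hb, hn, div_mul_eq_mul_div, Complex.div_ofReal_re, key]
  have hc : Integrable fun k => Ahat ρ v ω j k * invFT (fun x => (ρ x : ℂ)) k := by
    simp_rw [invFT_ofReal, FT_neg hρ]
    obtain ⟨G, hG⟩ := exists_schwartz_eq_FT ρ
    simp_rw [← hG]
    exact hA.mul_bdd (c := SchwartzMap.seminorm ℝ 0 0 G) G.continuous.aestronglyMeasurable
      (Filter.Eventually.of_forall (G.norm_le_seminorm ℝ))
  simp_rw [hreal] at h
  rw [integral_complex_ofReal] at h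
  have h' := congrArg Complex.re h
  rw [Complex.ofReal_re] at h'
  rw [chargeTerm, h']
  simp_rw [← hprod]
  exact (integral_re hc).symm

theorem Dv_pos {v : V2} (hv : ‖v‖ < 1) {k : V2} (hk : k ≠ 0) : 0 < Dv v k := by
  have hδ : 0 < 1 - ‖v‖ ^ 2 := by nlinarith [norm_nonneg v]
  have := norm_pos_iff.2 hk
  exact lt_of_lt_of_le (by positivity) (le_Dv v k)

theorem integrable_mul_div_Dv {v : V2} (hv : ‖v‖ < 1) {a s : V2 → ℝ} {B M : ℝ}
    (ha : Measurable a) (hs : Measurable s) (hB : ∀ k, |a k| ≤ B)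
    (hM : ∀ k, |s k| ≤ M * (‖k‖ ^ 2 * weight k)) : Integrable fun k => a k * s k / Dv v k := by
  have hD := measurable_Dv v
  have hδ : 0 < 1 - ‖v‖ ^ 2 := by nlinarith [norm_nonneg v]
  have hB0 : 0 ≤ B := (abs_nonneg _).trans (hB 0)
  refine ((integrable_weight.const_mul (B * |M| / (1 - ‖v‖ ^ 2))).mono'
    ((ha.mul hs).div hD).aestronglyMeasurable (Filter.Eventually.of_forall fun k => ?_))
  have hw := weight_pos k
  rcases eq_or_ne k 0 with rfl | hk
  · simp only [Dv, norm_zero, inner_zero_right]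
    norm_num
    positivity
  have hpos := Dv_pos hv hk
  have hn := norm_pos_iff.2 hk
  simp only [Real.norm_eq_abs, abs_div, abs_mul, abs_of_pos hpos]
  rw [div_le_iff₀ hpos]
  calc |a k| * |s k| ≤ B * (|M| * (‖k‖ ^ 2 * weight k)) := by
        gcongr
        · exact hB k
        · exact (hM k).trans (by gcongr; exact le_abs_self M)
    _ = B * |M| / (1 - ‖v‖ ^ 2) * weight k * ((1 - ‖v‖ ^ 2) * ‖k‖ ^ 2) := by
        field_simp
    _ ≤ _ := by
        gcongr
        exact le_Dv v k

theorem abs_inner_mul_coord_le {v : V2} (hv : ‖v‖ < 1) (k : V2) (j : Fin 2) :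
    |(⟪v, k⟫ : ℝ) * k j| ≤ ‖k‖ ^ 2 := by
  rw [abs_mul]
  calc _ ≤ (‖v‖ * ‖k‖) * ‖k‖ := mul_le_mul (abs_real_inner_le_norm v k) (abs_coord_le_norm k j)
        (abs_nonneg _) (by positivity)
    _ ≤ (1 * ‖k‖) * ‖k‖ := by gcongr
    _ = _ := by ring

theorem abs_inner_mul_coord_div_Dv_le {v : V2} (hv : ‖v‖ < 1) (k : V2) (j : Fin 2) :
    |(⟪v, k⟫ : ℝ) * k j / Dv v k| ≤ 1 / (1 - ‖v‖ ^ 2) := by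
  have hδ : 0 < 1 - ‖v‖ ^ 2 := by nlinarith [norm_nonneg v]
  rcases eq_or_ne k 0 with rfl | hk
  · simp [hδ.le]
  have hpos := Dv_pos hv hk
  rw [abs_div, abs_of_pos hpos, div_le_div_iff₀ hpos hδ, one_mul]
  calc _ ≤ ‖k‖ ^ 2 * (1 - ‖v‖ ^ 2) := by gcongr; exact abs_inner_mul_coord_le hv k j
    _ = (1 - ‖v‖ ^ 2) * ‖k‖ ^ 2 := mul_comm _ _
    _ ≤ _ := le_Dv v k

theorem abs_norm_sq_sub_inner_sq_div_le {v : V2} (hv : ‖v‖ < 1) (k : V2) :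
    |‖v‖ ^ 2 - (⟪v, k⟫ : ℝ) ^ 2 / ‖k‖ ^ 2| ≤ 1 := by
  have h1 : (⟪v, k⟫ : ℝ) ^ 2 / ‖k‖ ^ 2 ≤ 1 := by
    refine div_le_one_of_le₀ ?_ (by positivity)
    have := le_Dv v k
    rw [Dv] at this
    nlinarith [mul_le_mul_of_nonneg_right (show ‖v‖ ^ 2 ≤ 1 by nlinarith [norm_nonneg v])
      (sq_nonneg ‖k‖)]
  have h2 : 0 ≤ (⟪v, k⟫ : ℝ) ^ 2 / ‖k‖ ^ 2 := by positivity
  rw [abs_le]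
  constructor <;> nlinarith [norm_nonneg v]

theorem sq_le_of_le_mul_weight {C x : ℝ} (hx : 0 ≤ x) {k : V2} (h : x ≤ C * (‖k‖ * weight k)) :
    x ^ 2 ≤ C ^ 2 * (‖k‖ ^ 2 * weight k) := by
  have hw := weight_pos k
  calc x ^ 2 ≤ (C * (‖k‖ * weight k)) ^ 2 := by gcongr
    _ = C ^ 2 * (‖k‖ ^ 2 * (weight k * weight k)) := by ring
    _ ≤ C ^ 2 * (‖k‖ ^ 2 * (weight k * 1)) := by
        gcongr
        exact weight_le_one k
    _ = _ := by rw [mul_one]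

theorem exists_sq_norm_FT_le (ρ : SchwartzMap V2 ℝ) (hρ : ∀ x, ρ (-x) = ρ x)
    (hneu : ∫ x, ρ x = 0) :
    ∃ M, (∀ k, |‖FT ρ k‖ ^ 2| ≤ M * (‖k‖ ^ 2 * weight k)) ∧
      ∀ k, |gradNormSqC (FT ρ) k| ≤ M * (‖k‖ ^ 2 * weight k) := by
  obtain ⟨C, -, hF, hP⟩ := exists_norm_FT_le ρ hρ hneu
  refine ⟨2 * C ^ 2, fun k => ?_, fun k => ?_⟩
  · have h := sq_le_of_le_mul_weight (norm_nonneg _) (hF k)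
    rw [abs_of_nonneg (by positivity)]
    linarith [sq_nonneg ‖FT ρ k‖]
  · have h := fun j => sq_le_of_le_mul_weight (norm_nonneg _) (hP j k)
    rw [gradNormSqC, Fin.sum_univ_two, abs_of_nonneg (by positivity)]
    linarith [h 0, h 1]

theorem integral_mul_sum_norm_sq_Ahat (ρ : SchwartzMap V2 ℝ) (hρ : ∀ x, ρ (-x) = ρ x)
    (hneu : ∫ x, ρ x = 0) {v : V2} (hv : ‖v‖ < 1) (ω : ℝ) (j : Fin 2) :
    ∫ k, ⟪v, k⟫ * k j * ∑ l, ‖Ahat ρ v ω l k‖ ^ 2 =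
      (∫ k : V2, (‖v‖ ^ 2 - (⟪v, k⟫ : ℝ) ^ 2 / ‖k‖ ^ 2) * (⟪v, k⟫ : ℝ) * k j
          * ‖FT ρ k‖ ^ 2 / (Dv v k) ^ 2)
        + ω ^ 2 * ∫ k : V2, (⟪v, k⟫ : ℝ) * k j * gradNormSqC (FT ρ) k / (Dv v k) ^ 2 := by
  obtain ⟨M, hF, hP⟩ := exists_sq_norm_FT_le ρ hρ hneu
  have hD := measurable_Dv v
  have hmF := (continuous_FT ρ).measurable
  have hmP := fun i => (continuous_pd_FT ρ i).measurable
  have h1 := integrable_mul_div_Dv hv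
    (a := fun k => (‖v‖ ^ 2 - (⟪v, k⟫ : ℝ) ^ 2 / ‖k‖ ^ 2) * (⟪v, k⟫ * k j / Dv v k))
    (s := fun k => ‖FT ρ k‖ ^ 2) (B := 1 * (1 / (1 - ‖v‖ ^ 2))) (by fun_prop) (by fun_prop)
    (fun k => by
      rw [abs_mul]
      exact mul_le_mul (abs_norm_sq_sub_inner_sq_div_le hv k)
        (abs_inner_mul_coord_div_Dv_le hv k j) (abs_nonneg _) zero_le_one) hF
  have h2 := integrable_mul_div_Dv hv (a := fun k => ⟪v, k⟫ * k j / Dv v k)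
    (s := gradNormSqC (FT ρ)) (by fun_prop) (by unfold gradNormSqC; fun_prop)
    (fun k => abs_inner_mul_coord_div_Dv_le hv k j) hP
  rw [← integral_const_mul, ← integral_add]
  · refine integral_congr_ae (Filter.Eventually.of_forall fun k => ?_)
    simp only [sum_norm_sq_Ahat ρ hρ]
    ring
  · refine h1.congr (Filter.Eventually.of_forall fun k => ?_)
    simp only
    ring
  · refine (h2.congr (Filter.Eventually.of_forall fun k => ?_)).const_mul _
    simp only
    ring

theorem integral_projected_sq_norm_FT (ρ : SchwartzMap V2 ℝ) (hρ : ∀ x, ρ (-x) = ρ x)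
    (hneu : ∫ x, ρ x = 0) {v : V2} (hv : ‖v‖ < 1) (j : Fin 2) :
    ∫ k, (v j - k j * ⟪v, k⟫ / ‖k‖ ^ 2) * ‖FT ρ k‖ ^ 2 / Dv v k =
      v j * (∫ k : V2, ‖FT ρ k‖ ^ 2 / Dv v k)
        - ∫ k : V2, (⟪v, k⟫ : ℝ) * k j * ‖FT ρ k‖ ^ 2 / (‖k‖ ^ 2 * Dv v k) := by
  obtain ⟨M, hF, -⟩ := exists_sq_norm_FT_le ρ hρ hneu
  have hmF := (continuous_FT ρ).measurable
  have h1 := integrable_mul_div_Dv hv (a := fun _ => v j) (s := fun k => ‖FT ρ k‖ ^ 2)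
    measurable_const (by fun_prop) (fun _ => le_rfl) hF
  have h2 := integrable_mul_div_Dv hv (a := fun k => ⟪v, k⟫ * k j / ‖k‖ ^ 2)
    (s := fun k => ‖FT ρ k‖ ^ 2) (B := 1) (by fun_prop) (by fun_prop)
    (fun k => by
      rw [abs_div, abs_of_nonneg (sq_nonneg ‖k‖)]
      exact div_le_one_of_le₀ (abs_inner_mul_coord_le hv k j) (sq_nonneg _)) hF
  rw [← integral_const_mul, ← integral_sub]
  · refine integral_congr_ae (Filter.Eventually.of_forall fun k => ?_)
    simp only
    rw [mul_comm (‖k‖ ^ 2), ← div_div]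
    ring
  · refine h1.congr (Filter.Eventually.of_forall fun k => ?_)
    simp only
    ring
  · refine h2.congr (Filter.Eventually.of_forall fun k => ?_)
    simp only
    rw [mul_comm (‖k‖ ^ 2), ← div_div]
    ring

end SolitonField

/-- Fourier formula for the components of the soliton linear momentum
`P_{v,ω} = mv - ⟨Π_{v,ω},∇_*A_{v,ω}⟩ + ⟨A_{v,ω},ρ⟩`. -/
theorem linear_momentum_formula
    (ρ : SchwartzMap V2 ℝ)
    (hrad : ∀ x y : V2, ‖x‖ = ‖y‖ → ρ x = ρ y)
    (hneu : (∫ x : V2, ρ x) = 0)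
    (m : ℝ) (hm : 0 < m)
    (v : V2) (hv : ‖v‖ < 1) (ω : ℝ) (j : Fin 2) :
    Psol (⇑ρ) m v ω j
      = m * v j
        + v j * (∫ k : V2, ‖FT (⇑ρ) k‖ ^ 2 / Dv v k)
        - (∫ k : V2, (⟪v, k⟫ : ℝ) * k j * ‖FT (⇑ρ) k‖ ^ 2 / (‖k‖ ^ 2 * Dv v k))
        + (∫ k : V2, (‖v‖ ^ 2 - (⟪v, k⟫ : ℝ) ^ 2 / ‖k‖ ^ 2) * (⟪v, k⟫ : ℝ) * k j
            * ‖FT (⇑ρ) k‖ ^ 2 / (Dv v k) ^ 2)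
        + ω ^ 2 * (∫ k : V2, (⟪v, k⟫ : ℝ) * k j * gradNormSqC (FT (⇑ρ)) k / (Dv v k) ^ 2) := by
  have hρ : ∀ x, ρ (-x) = ρ x := fun x => hrad _ _ (norm_neg x)
  rw [Psol, momTerm_soliton ρ hρ hneu hv, chargeTerm_soliton ρ hρ hneu hv,
    integral_mul_sum_norm_sq_Ahat ρ hρ hneu hv, integral_projected_sq_norm_FT ρ hρ hneu hv]
  ring

end
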